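/- arXiv:2007.10626 — 4 statements merged into one kernel-verified Lean document; each statement's English description precedes it below -/
import Mathlib

section
/- Let n1, r, n2, n3 be positive natural numbers, let b > 0 and let ϑ ≥ 8 be a real number. Let A, ΔA be real tensors of size n1 × r × n3 and B, ΔB real tensors of size r × n2 × n3 such that 0 ≤ A(i,l,t) ≤ 1 and |ΔA(i,l,t)| ≤ 1/(ϑ−1) for all entries, and 0 ≤ B(l,j,t) ≤ b and |ΔB(l,j,t)| ≤ b/(ϑ−1) for all entries. Then ‖(A+ΔA) ⋄ (B+ΔB) − A ⋄ B‖_∞ ≤ 3 · r · n3 · b / ϑ. -/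
open scoped BigOperators

/-- Tensor-tensor product of third-order tensors (circular convolution along the third mode). -/
noncomputable def tProd {n1 r n2 n3 : ℕ} [NeZero n3]
    (A : Fin n1 → Fin r → ZMod n3 → ℝ) (B : Fin r → Fin n2 → ZMod n3 → ℝ) :
    Fin n1 → Fin n2 → ZMod n3 → ℝ :=
  fun i j k => ∑ l : Fin r, ∑ t : ZMod n3, A i l t * B l j (k - t)

/-- Tensor ℓ∞ norm: the maximum absolute value of the entries. -/
noncomputable def tinfty {n1 n2 n3 : ℕ} [NeZero n3]
    (X : Fin n1 → Fin n2 → ZMod n3 → ℝ) : ℝ :=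
  ⨆ i, ⨆ j, ⨆ k, |X i j k|

/-- Perturbing the factors of `a * c` with `|a| ≤ 1`, `|c| ≤ b` by a relative error of at most
`1 / (ϑ - 1)` changes the product by at most `3 * b / ϑ`. -/
lemma abs_perturbed_mul_sub_mul_le {b ϑ a δa c δc : ℝ} (hb : 0 ≤ b) (hϑ : 8 ≤ ϑ)
    (ha : |a| ≤ 1) (hδa : |δa| ≤ 1 / (ϑ - 1)) (hc : |c| ≤ b) (hδc : |δc| ≤ b / (ϑ - 1)) :
    |(a + δa) * (c + δc) - a * c| ≤ 3 * b / ϑ := by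
  have hϑ1 : 0 < ϑ - 1 := by linarith
  calc |(a + δa) * (c + δc) - a * c| = |a * δc + δa * c + δa * δc| := by ring_nf
    _ ≤ |a| * |δc| + |δa| * |c| + |δa| * |δc| := by
      simpa only [abs_mul] using abs_add_three (a * δc) (δa * c) (δa * δc)
    _ ≤ 1 * (b / (ϑ - 1)) + 1 / (ϑ - 1) * b + 1 / (ϑ - 1) * (b / (ϑ - 1)) := by gcongr
    _ = b * ((2 * ϑ - 1) / (ϑ - 1) ^ 2) := by
      field_simp
      ring
    _ ≤ b * (3 / ϑ) := by
      refine mul_le_mul_of_nonneg_left ?_ hb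
      rw [div_le_div_iff₀ (by positivity) (by linarith)]
      nlinarith
    _ = 3 * b / ϑ := by ring

/-- An entrywise bound bounds the tensor ℓ∞ norm. -/
lemma tinfty_le {n1 n2 n3 : ℕ} [NeZero n3] {X : Fin n1 → Fin n2 → ZMod n3 → ℝ} {C : ℝ}
    (hC : 0 ≤ C) (hX : ∀ i j k, |X i j k| ≤ C) : tinfty X ≤ C :=
  Real.iSup_le (fun i => Real.iSup_le (fun j => Real.iSup_le (hX i j) hC) hC) hC

theorem discretization_error_bound {n1 r n2 n3 : ℕ} [NeZero n3]
    (hn1 : 0 < n1) (hr : 0 < r) (hn2 : 0 < n2) (hn3 : 0 < n3)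
    (b ϑ : ℝ) (hb : 0 < b) (hϑ : 8 ≤ ϑ)
    (A ΔA : Fin n1 → Fin r → ZMod n3 → ℝ) (B ΔB : Fin r → Fin n2 → ZMod n3 → ℝ)
    (hA : ∀ i l t, 0 ≤ A i l t ∧ A i l t ≤ 1)
    (hΔA : ∀ i l t, |ΔA i l t| ≤ 1 / (ϑ - 1))
    (hB : ∀ l j t, 0 ≤ B l j t ∧ B l j t ≤ b)
    (hΔB : ∀ l j t, |ΔB l j t| ≤ b / (ϑ - 1)) :
    tinfty (fun i j k =>
        tProd (fun i l t => A i l t + ΔA i l t) (fun l j t => B l j t + ΔB l j t) i j k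
          - tProd A B i j k)
      ≤ 3 * (r : ℝ) * (n3 : ℝ) * b / ϑ := by
  have hϑ0 : 0 < ϑ := by linarith
  refine tinfty_le (by positivity) fun i j k => ?_
  simp only [tProd, ← Finset.sum_sub_distrib]
  calc |∑ l : Fin r, ∑ t : ZMod n3,
        ((A i l t + ΔA i l t) * (B l j (k - t) + ΔB l j (k - t)) - A i l t * B l j (k - t))|
      ≤ ∑ _l : Fin r, ∑ _t : ZMod n3, 3 * b / ϑ := by
        refine (Finset.abs_sum_le_sum_abs _ _).trans (Finset.sum_le_sum fun l _ => ?_)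
        refine (Finset.abs_sum_le_sum_abs _ _).trans (Finset.sum_le_sum fun t _ => ?_)
        obtain ⟨hA0, hA1⟩ := hA i l t
        obtain ⟨hB0, hB1⟩ := hB l j (k - t)
        exact abs_perturbed_mul_sub_mul_le hb.le hϑ (by rwa [abs_of_nonneg hA0]) (hΔA i l t)
          (by rwa [abs_of_nonneg hB0]) (hΔB l j (k - t))
    _ = 3 * (r : ℝ) * (n3 : ℝ) * b / ϑ := by
      simp only [Finset.sum_const, Finset.card_univ, ZMod.card, Fintype.card_fin, nsmul_eq_mul]
      ring
end

section
/- Let μ1, μ2 be real numbers and b1, b2 > 0. Then the Kullback–Leibler divergence between the Laplace densities f_{μ1,b1} and f_{μ2,b2} satisfies ∫_ℝ f_{μ1,b1}(x) · log( f_{μ1,b1}(x) / f_{μ2,b2}(x) ) dx = log(b2/b1) − 1 + |μ2 − μ1|/b2 + (b1/b2) · exp(−|μ2 − μ1|/b1). -/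
open MeasureTheory

/-- The Laplace density with location μ and scale b. -/
noncomputable def laplaceDensity (μ b x : ℝ) : ℝ :=
  (1 / (2 * b)) * Real.exp (-|x - μ| / b)

open Set Filter Topology in
/-- The tail moment `∫ x in (a, ∞), (x - a) e^{-x/b}`. -/
theorem integral_Ioi_sub_mul_exp_neg_div (a : ℝ) {b : ℝ} (hb : 0 < b) :
    IntegrableOn (fun x : ℝ => (x - a) * Real.exp (-x / b)) (Ioi a) ∧
      ∫ x in Ioi a, (x - a) * Real.exp (-x / b) = b ^ 2 * Real.exp (-a / b) := by
  have hderiv : ∀ x ∈ Ici a, HasDerivAt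
      (fun x : ℝ => -(b * (x - a) + b ^ 2) * Real.exp (-x / b))
      ((x - a) * Real.exp (-x / b)) x := by
    intro x _
    have h₁ : HasDerivAt (fun x : ℝ => -(b * (x - a) + b ^ 2)) (-(b * 1)) x :=
      ((((hasDerivAt_id x).sub_const a).const_mul b).add_const (b ^ 2)).neg
    have h₂ : HasDerivAt (fun x : ℝ => Real.exp (-x / b)) (Real.exp (-x / b) * (-1 / b)) x :=
      ((hasDerivAt_id x).neg.div_const b).exp
    refine (h₁.mul h₂).congr_deriv ?_
    field_simp
    ring
  have hnonneg : ∀ x ∈ Ioi a, 0 ≤ (x - a) * Real.exp (-x / b) := fun x hx =>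
    mul_nonneg (sub_nonneg.2 (le_of_lt hx)) (Real.exp_pos _).le
  have hlim : Tendsto (fun x : ℝ => -(b * (x - a) + b ^ 2) * Real.exp (-x / b)) atTop (𝓝 0) := by
    have hdiv : Tendsto (fun x : ℝ => x / b) atTop atTop := tendsto_id.atTop_div_const hb
    have h₀ := (Real.tendsto_pow_mul_exp_neg_atTop_nhds_zero 0).comp hdiv
    have h₁ := (Real.tendsto_pow_mul_exp_neg_atTop_nhds_zero 1).comp hdiv
    have h := (h₁.const_mul (-b ^ 2)).add (h₀.const_mul (b * a - b ^ 2))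
    simp only [mul_zero, add_zero] at h
    refine h.congr fun x => ?_
    simp only [Function.comp_apply, pow_one, pow_zero, ← neg_div]
    field_simp
    ring
  refine ⟨integrableOn_Ioi_deriv_of_nonneg' hderiv hnonneg hlim, ?_⟩
  rw [integral_Ioi_of_hasDerivAt_of_nonneg' hderiv hnonneg hlim]
  ring

open Set in
theorem integral_Ioi_exp_neg_div {b : ℝ} (hb : 0 < b) :
    IntegrableOn (fun x : ℝ => Real.exp (-x / b)) (Ioi 0) ∧
      ∫ x in Ioi (0 : ℝ), Real.exp (-x / b) = b := by
  have h : -b⁻¹ < 0 := neg_lt_zero.2 (inv_pos.2 hb)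
  have heq : (fun x : ℝ => Real.exp (-x / b)) = fun x => Real.exp (-b⁻¹ * x) := by
    ext x
    ring_nf
  rw [heq]
  refine ⟨integrableOn_exp_mul_Ioi h 0, ?_⟩
  rw [integral_exp_mul_Ioi h 0]
  simp

theorem integral_exp_neg_abs_div {b : ℝ} (hb : 0 < b) :
    ∫ x : ℝ, Real.exp (-|x| / b) = 2 * b := by
  rw [integral_comp_abs (f := fun x => Real.exp (-x / b)), (integral_Ioi_exp_neg_div hb).2]

theorem integrable_exp_neg_abs_div {b : ℝ} (hb : 0 < b) :
    Integrable fun x : ℝ => Real.exp (-|x| / b) :=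
  not_imp_comm.1 integral_undef (by rw [integral_exp_neg_abs_div hb]; positivity)

theorem integrable_exp_neg_abs_div_mul_abs {b : ℝ} (hb : 0 < b) :
    Integrable fun x : ℝ => Real.exp (-|x| / b) * |x| := by
  refine not_imp_comm.1 integral_undef ?_
  have h := (integral_Ioi_sub_mul_exp_neg_div 0 hb).2
  simp only [sub_zero, mul_comm _ (Real.exp _)] at h
  rw [integral_comp_abs (f := fun x => Real.exp (-x / b) * x), h]
  positivity

theorem integrable_exp_neg_abs_div_mul_abs_sub {b : ℝ} (hb : 0 < b) (c : ℝ) :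
    Integrable fun x : ℝ => Real.exp (-|x| / b) * |x - c| := by
  refine ((integrable_exp_neg_abs_div_mul_abs hb).add
    ((integrable_exp_neg_abs_div hb).mul_const |c|)).mono' (by fun_prop) ?_
  refine Filter.Eventually.of_forall fun x => ?_
  rw [Real.norm_of_nonneg (by positivity), Pi.add_apply, ← mul_add]
  exact mul_le_mul_of_nonneg_left (abs_sub x c) (Real.exp_pos _).le

open Set in
theorem integral_Ioi_exp_neg_div_mul_max {a b : ℝ} (ha : 0 ≤ a) (hb : 0 < b) :
    ∫ x in Ioi (0 : ℝ), Real.exp (-x / b) * max x a = b * a + b ^ 2 * Real.exp (-a / b) := by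
  obtain ⟨hint, hval⟩ := integral_Ioi_sub_mul_exp_neg_div a hb
  obtain ⟨hexp, hexp_val⟩ := integral_Ioi_exp_neg_div hb
  have hsplit : ∀ x : ℝ, Real.exp (-x / b) * max x a = Real.exp (-x / b) * a +
      (Ioi a).indicator (fun x => (x - a) * Real.exp (-x / b)) x := by
    intro x
    by_cases hx : a < x
    · rw [indicator_of_mem (mem_Ioi.2 hx), max_eq_left hx.le]
      ring
    · rw [indicator_of_notMem (by simpa using hx), max_eq_right (not_lt.1 hx), add_zero]
  simp_rw [hsplit]
  rw [integral_add (hexp.mul_const a)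
      ((integrable_indicator_iff measurableSet_Ioi).2 hint).integrableOn,
    integral_mul_const, hexp_val, setIntegral_indicator measurableSet_Ioi,
    inter_eq_right.2 (Ioi_subset_Ioi ha), hval]

theorem integral_exp_neg_abs_div_mul_abs_sub {b : ℝ} (hb : 0 < b) (c : ℝ) :
    ∫ x : ℝ, Real.exp (-|x| / b) * |x - c| = 2 * (b * |c| + b ^ 2 * Real.exp (-|c| / b)) := by
  have hneg : ∫ x : ℝ, Real.exp (-|x| / b) * |x - -c| =
      ∫ x : ℝ, Real.exp (-|x| / b) * |x - c| := by
    rw [← integral_neg_eq_self]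
    congr 1 with x
    rw [abs_neg, show -x - -c = -(x - c) by ring, abs_neg]
  have hmax : ∀ x : ℝ, Real.exp (-|x| / b) * |x - c| + Real.exp (-|x| / b) * |x - -c| =
      2 * (Real.exp (-|x| / b) * max |x| |c|) := by
    intro x
    have : |x - c| + |x - -c| = 2 * max |x| |c| := by grind
    linear_combination Real.exp (-|x| / b) * this
  have hadd := integral_add (integrable_exp_neg_abs_div_mul_abs_sub hb c)
    (integrable_exp_neg_abs_div_mul_abs_sub hb (-c))
  simp_rw [hmax] at hadd
  rw [hneg, integral_const_mul, integral_comp_abs (f := fun x => Real.exp (-x / b) * max x |c|),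
    integral_Ioi_exp_neg_div_mul_max (abs_nonneg c) hb] at hadd
  linarith

theorem integrable_laplaceDensity (μ : ℝ) {b : ℝ} (hb : 0 < b) :
    Integrable (laplaceDensity μ b) :=
  ((integrable_exp_neg_abs_div hb).comp_sub_right μ).const_mul _

theorem integral_laplaceDensity (μ : ℝ) {b : ℝ} (hb : 0 < b) :
    ∫ x, laplaceDensity μ b x = 1 := by
  simp only [laplaceDensity]
  rw [integral_const_mul, integral_sub_right_eq_self (fun x => Real.exp (-|x| / b)),
    integral_exp_neg_abs_div hb]
  field_simp

theorem laplaceDensity_mul_abs_sub (μ b c x : ℝ) :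
    laplaceDensity μ b x * |x - c| =
      1 / (2 * b) * (Real.exp (-|x - μ| / b) * |x - μ - (c - μ)|) := by
  rw [laplaceDensity, sub_sub_sub_cancel_right, mul_assoc]

theorem integrable_laplaceDensity_mul_abs_sub (μ c : ℝ) {b : ℝ} (hb : 0 < b) :
    Integrable fun x => laplaceDensity μ b x * |x - c| := by
  simp only [laplaceDensity_mul_abs_sub]
  exact ((integrable_exp_neg_abs_div_mul_abs_sub hb (c - μ)).comp_sub_right μ).const_mul _

/-- The mean absolute deviation of a Laplace distribution from an arbitrary point `c`. -/
theorem integral_laplaceDensity_mul_abs_sub (μ c : ℝ) {b : ℝ} (hb : 0 < b) :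
    ∫ x, laplaceDensity μ b x * |x - c| = |c - μ| + b * Real.exp (-|c - μ| / b) := by
  simp only [laplaceDensity_mul_abs_sub]
  rw [integral_const_mul,
    integral_sub_right_eq_self (fun x => Real.exp (-|x| / b) * |x - (c - μ)|),
    integral_exp_neg_abs_div_mul_abs_sub hb]
  field_simp

theorem log_laplaceDensity_div (μ1 μ2 x : ℝ) {b1 b2 : ℝ} (hb1 : 0 < b1) (hb2 : 0 < b2) :
    Real.log (laplaceDensity μ1 b1 x / laplaceDensity μ2 b2 x) =
      Real.log (b2 / b1) - |x - μ1| / b1 + |x - μ2| / b2 := by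
  have h : laplaceDensity μ1 b1 x / laplaceDensity μ2 b2 x =
      b2 / b1 * Real.exp (-|x - μ1| / b1 - -|x - μ2| / b2) := by
    rw [Real.exp_sub, laplaceDensity, laplaceDensity]
    field_simp
  rw [h, Real.log_mul (by positivity) (Real.exp_ne_zero _), Real.log_exp]
  ring

theorem laplace_KL_divergence (μ1 μ2 b1 b2 : ℝ) (hb1 : 0 < b1) (hb2 : 0 < b2) :
    ∫ x : ℝ, laplaceDensity μ1 b1 x * Real.log (laplaceDensity μ1 b1 x / laplaceDensity μ2 b2 x)
      = Real.log (b2 / b1) - 1 + |μ2 - μ1| / b2 + (b1 / b2) * Real.exp (-|μ2 - μ1| / b1) := by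
  have hsplit : ∀ x, laplaceDensity μ1 b1 x *
      Real.log (laplaceDensity μ1 b1 x / laplaceDensity μ2 b2 x) =
      laplaceDensity μ1 b1 x * Real.log (b2 / b1) - laplaceDensity μ1 b1 x * |x - μ1| / b1 +
        laplaceDensity μ1 b1 x * |x - μ2| / b2 := by
    intro x
    rw [log_laplaceDensity_div μ1 μ2 x hb1 hb2]
    ring
  have h₀ := (integrable_laplaceDensity μ1 hb1).mul_const (Real.log (b2 / b1))
  have h₁ := (integrable_laplaceDensity_mul_abs_sub μ1 μ1 hb1).div_const b1
  have h₂ := (integrable_laplaceDensity_mul_abs_sub μ1 μ2 hb1).div_const b2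
  simp_rw [hsplit]
  rw [integral_add (by exact h₀.sub h₁) h₂, integral_sub h₀ h₁, integral_mul_const, integral_div,
    integral_div, integral_laplaceDensity μ1 hb1, integral_laplaceDensity_mul_abs_sub μ1 μ1 hb1,
    integral_laplaceDensity_mul_abs_sub μ1 μ2 hb1]
  simp only [sub_self, abs_zero, neg_zero, zero_div, Real.exp_zero]
  field_simp
  ring
end

section
/- Let μ1, μ2 be real numbers and b1 > 0. Then ∫_ℝ |x − μ2| · f_{μ1,b1}(x) dx = |μ2 − μ1| + b1 · exp(−|μ2 − μ1|/b1). -/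
open MeasureTheory

open Set Filter Topology

theorem hasDerivAt_neg_add_one_mul_exp_neg (t : ℝ) :
    HasDerivAt (fun t : ℝ => -((t + 1) * Real.exp (-t))) (t * Real.exp (-t)) t := by
  refine (((hasDerivAt_id' t).add_const 1).mul (hasDerivAt_id' t).neg.exp).neg.congr_deriv ?_
  simp only [Pi.neg_apply]
  ring

theorem tendsto_neg_add_one_mul_exp_neg :
    Tendsto (fun t : ℝ => -((t + 1) * Real.exp (-t))) atTop (𝓝 0) := by
  have h := ((Real.tendsto_pow_mul_exp_neg_atTop_nhds_zero 1).add
    (Real.tendsto_pow_mul_exp_neg_atTop_nhds_zero 0)).neg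
  simpa [add_mul] using h

theorem integrableOn_mul_exp_neg_Ioi {a : ℝ} (ha : 0 ≤ a) :
    IntegrableOn (fun t : ℝ => t * Real.exp (-t)) (Ioi a) :=
  integrableOn_Ioi_deriv_of_nonneg' (fun t _ => hasDerivAt_neg_add_one_mul_exp_neg t)
    (fun _ ht => mul_nonneg (ha.trans (le_of_lt ht)) (Real.exp_pos _).le)
    tendsto_neg_add_one_mul_exp_neg

theorem integral_mul_exp_neg_Ioi {a : ℝ} (ha : 0 ≤ a) :
    ∫ t in Ioi a, t * Real.exp (-t) = (a + 1) * Real.exp (-a) := by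
  rw [integral_Ioi_of_hasDerivAt_of_tendsto' (fun t _ => hasDerivAt_neg_add_one_mul_exp_neg t)
    (integrableOn_mul_exp_neg_Ioi ha) tendsto_neg_add_one_mul_exp_neg]
  ring

theorem integral_max_mul_exp_neg_Ioi {a : ℝ} (ha : 0 ≤ a) :
    ∫ t in Ioi 0, max t a * Real.exp (-t) = a + Real.exp (-a) := by
  have heq : EqOn (fun t : ℝ => t * Real.exp (-t)) (fun t => max t a * Real.exp (-t)) (Ioi a) :=
    fun t ht => by simp only [max_eq_left (le_of_lt (mem_Ioi.1 ht))]
  have hcont : Continuous fun t : ℝ => max t a * Real.exp (-t) := by fun_prop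
  rw [← intervalIntegral.integral_interval_add_Ioi' (hcont.intervalIntegrable 0 a)
    ((integrableOn_mul_exp_neg_Ioi ha).congr_fun heq measurableSet_Ioi),
    ← setIntegral_congr_fun measurableSet_Ioi heq, integral_mul_exp_neg_Ioi ha]
  have hint : ∫ t in (0 : ℝ)..a, max t a * Real.exp (-t) = ∫ t in (0 : ℝ)..a, a * Real.exp (-t) := by
    refine intervalIntegral.integral_congr fun t ht => ?_
    rw [uIcc_of_le ha] at ht
    simp only [max_eq_right ht.2]
  rw [hint, intervalIntegral.integral_const_mul,
    intervalIntegral.integral_comp_neg fun t => Real.exp t, integral_exp]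
  simp
  ring

theorem integral_max_abs_mul_exp_neg_abs {a : ℝ} (ha : 0 ≤ a) :
    ∫ t : ℝ, max |t| a * Real.exp (-|t|) = 2 * (a + Real.exp (-a)) := by
  rw [integral_comp_abs (f := fun t => max t a * Real.exp (-t)), integral_max_mul_exp_neg_Ioi ha]

theorem integrable_max_abs_mul_exp_neg_abs {a : ℝ} (ha : 0 ≤ a) :
    Integrable fun t : ℝ => max |t| a * Real.exp (-|t|) := by
  refine Integrable.of_integral_ne_zero ?_
  rw [integral_max_abs_mul_exp_neg_abs ha]
  positivity

theorem abs_sub_add_abs_add (t c : ℝ) : |t - c| + |t + c| = 2 * max |t| |c| := by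
  grind

theorem integrable_abs_sub_mul_exp_neg_abs (c : ℝ) :
    Integrable fun t : ℝ => |t - c| * Real.exp (-|t|) := by
  refine ((integrable_max_abs_mul_exp_neg_abs (abs_nonneg c)).const_mul 2).mono'
    (by fun_prop) (.of_forall fun t => ?_)
  rw [Real.norm_of_nonneg (by positivity), ← mul_assoc, ← abs_sub_add_abs_add]
  gcongr
  exact le_add_of_nonneg_right (abs_nonneg _)

theorem integral_abs_sub_mul_exp_neg_abs (c : ℝ) :
    ∫ t : ℝ, |t - c| * Real.exp (-|t|) = 2 * (|c| + Real.exp (-|c|)) := by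
  have hneg : ∫ t : ℝ, |t - c| * Real.exp (-|t|) = ∫ t : ℝ, |t + c| * Real.exp (-|t|) := by
    rw [← integral_neg_eq_self]
    refine integral_congr_ae (.of_forall fun t => ?_)
    simp only [abs_neg, ← abs_neg (-t - c), neg_sub, sub_neg_eq_add, add_comm]
  have hadd : (∫ t : ℝ, |t - c| * Real.exp (-|t|)) + ∫ t : ℝ, |t + c| * Real.exp (-|t|) =
      2 * ∫ t : ℝ, max |t| |c| * Real.exp (-|t|) := by
    rw [← integral_add (integrable_abs_sub_mul_exp_neg_abs c)
      (by simpa using integrable_abs_sub_mul_exp_neg_abs (-c)), ← integral_const_mul]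
    simp only [← add_mul, abs_sub_add_abs_add, mul_assoc]
  rw [integral_max_abs_mul_exp_neg_abs (abs_nonneg c)] at hadd
  linarith

theorem laplace_mean_abs_deviation (μ1 μ2 b1 : ℝ) (hb1 : 0 < b1) :
    ∫ x : ℝ, |x - μ2| * laplaceDensity μ1 b1 x
      = |μ2 - μ1| + b1 * Real.exp (-|μ2 - μ1| / b1) := by
  have hscale : ∀ x : ℝ, |x - μ2| * laplaceDensity μ1 b1 x =
      (fun y => (1 / 2) * (|y / b1 - (μ2 - μ1) / b1| * Real.exp (-|y / b1|))) (x - μ1) := by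
    intro x
    simp only [laplaceDensity]
    rw [← sub_div, abs_div, abs_div, abs_of_pos hb1, sub_sub_sub_cancel_right, neg_div]
    field_simp
  simp_rw [hscale]
  rw [integral_sub_right_eq_self (fun y : ℝ =>
      (1 / 2) * (|y / b1 - (μ2 - μ1) / b1| * Real.exp (-|y / b1|))), integral_const_mul,
    Measure.integral_comp_div (fun t => |t - (μ2 - μ1) / b1| * Real.exp (-|t|)),
    integral_abs_sub_mul_exp_neg_abs, abs_div, abs_of_pos hb1, smul_eq_mul, neg_div]
  field_simp
end

section
/- Let μ1, μ2 be real numbers and b > 0. Then the Hellinger affinity between the Laplace densities f_{μ1,b} and f_{μ2,b} satisfies ∫_ℝ √( f_{μ1,b}(x) · f_{μ2,b}(x) ) dx = exp(−|μ2 − μ1|/(2b)) · (1 + |μ2 − μ1|/(2b)). Consequently, −2·log( ∫_ℝ √( f_{μ1,b}(x) · f_{μ2,b}(x) ) dx ) = |μ2 − μ1|/b − 2·log(1 + |μ2 − μ1|/(2b)). -/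
open MeasureTheory

theorem sqrt_laplaceDensity_mul_laplaceDensity (μ₁ μ₂ x : ℝ) {b : ℝ} (hb : 0 < b) :
    Real.sqrt (laplaceDensity μ₁ b x * laplaceDensity μ₂ b x)
      = 1 / (2 * b) * Real.exp (-(|x - μ₁| + |x - μ₂|) / (2 * b)) := by
  rw [Real.sqrt_eq_iff_mul_self_eq_of_pos (by positivity), laplaceDensity, laplaceDensity,
    mul_mul_mul_comm, mul_mul_mul_comm (1 / (2 * b)) (Real.exp (-|x - μ₁| / b)),
    ← Real.exp_add, ← Real.exp_add]
  congr 2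
  field_simp
  ring

theorem integral_exp_neg_abs_sub_add_abs_sub {m n c : ℝ} (hc : 0 < c) (hmn : m ≤ n) :
    ∫ x : ℝ, Real.exp (-(|x - m| + |x - n|) / c)
      = Real.exp (-(n - m) / c) * (c + (n - m)) := by
  have left : Set.EqOn (fun x : ℝ => Real.exp (-(|x - m| + |x - n|) / c))
      (fun x => Real.exp (-(m + n) / c) * Real.exp (2 / c * x)) (Set.Iic m) := fun x hx => by
    have hx : x ≤ m := hx
    simp only
    rw [abs_of_nonpos (by linarith), abs_of_nonpos (by linarith), ← Real.exp_add]
    ring_nf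
  have middle : Set.EqOn (fun x : ℝ => Real.exp (-(|x - m| + |x - n|) / c))
      (fun _ => Real.exp (-(n - m) / c)) (Set.Ioc m n) := fun x hx => by
    simp only
    rw [abs_of_nonneg (by linarith [hx.1]), abs_of_nonpos (by linarith [hx.2])]
    ring_nf
  have right : Set.EqOn (fun x : ℝ => Real.exp (-(|x - m| + |x - n|) / c))
      (fun x => Real.exp ((m + n) / c) * Real.exp (-2 / c * x)) (Set.Ioi n) := fun x hx => by
    have hx : n < x := hx
    simp only
    rw [abs_of_nonneg (by linarith), abs_of_nonneg (by linarith), ← Real.exp_add]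
    ring_nf
  have pos : 0 < 2 / c := by positivity
  have neg : -2 / c < 0 := div_neg_of_neg_of_pos (by norm_num) hc
  have intLeft := (IntegrableOn.congr_fun
    ((integrableOn_exp_mul_Iic pos m).const_mul (Real.exp (-(m + n) / c)))
    left.symm measurableSet_Iic)
  have intMiddle := (IntegrableOn.congr_fun
    (integrableOn_const (C := Real.exp (-(n - m) / c)) (μ := volume) (s := Set.Ioc m n)
      (by simp)) middle.symm measurableSet_Ioc)
  have intRight := (IntegrableOn.congr_fun
    ((integrableOn_exp_mul_Ioi neg n).const_mul (Real.exp ((m + n) / c)))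
    right.symm measurableSet_Ioi)
  have intIoi := intMiddle.union intRight
  rw [Set.Ioc_union_Ioi_eq_Ioi hmn] at intIoi
  have expLeft : Real.exp (-(m + n) / c) * Real.exp (2 / c * m) = Real.exp (-(n - m) / c) := by
    rw [← Real.exp_add]
    ring_nf
  have expRight : Real.exp ((m + n) / c) * Real.exp (-2 / c * n) = Real.exp (-(n - m) / c) := by
    rw [← Real.exp_add]
    ring_nf
  rw [← intervalIntegral.integral_Iic_add_Ioi intLeft intIoi, ← Set.Ioc_union_Ioi_eq_Ioi hmn,
    setIntegral_union (Set.Ioc_disjoint_Ioi le_rfl) measurableSet_Ioi intMiddle intRight,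
    setIntegral_congr_fun measurableSet_Iic left, setIntegral_congr_fun measurableSet_Ioc middle,
    setIntegral_congr_fun measurableSet_Ioi right, integral_const_mul, integral_const_mul,
    integral_exp_mul_Iic pos, integral_exp_mul_Ioi neg, setIntegral_const,
    Real.volume_real_Ioc_of_le hmn, smul_eq_mul, mul_div_assoc', expLeft, mul_div_assoc', mul_neg,
    expRight]
  field_simp
  ring

theorem integral_sqrt_laplaceDensity_mul_laplaceDensity (μ₁ μ₂ : ℝ) {b : ℝ} (hb : 0 < b) :
    ∫ x : ℝ, Real.sqrt (laplaceDensity μ₁ b x * laplaceDensity μ₂ b x)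
      = Real.exp (-|μ₂ - μ₁| / (2 * b)) * (1 + |μ₂ - μ₁| / (2 * b)) := by
  wlog h : μ₁ ≤ μ₂ generalizing μ₁ μ₂
  · simpa only [mul_comm (laplaceDensity μ₂ b _), abs_sub_comm μ₁ μ₂]
      using this μ₂ μ₁ (le_of_not_ge h)
  simp_rw [sqrt_laplaceDensity_mul_laplaceDensity μ₁ μ₂ _ hb]
  rw [integral_const_mul, integral_exp_neg_abs_sub_add_abs_sub (by positivity) h,
    abs_of_nonneg (sub_nonneg.mpr h)]
  field_simp

theorem laplace_hellinger_affinity (μ1 μ2 b : ℝ) (hb : 0 < b) :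
    (∫ x : ℝ, Real.sqrt (laplaceDensity μ1 b x * laplaceDensity μ2 b x)
        = Real.exp (-|μ2 - μ1| / (2 * b)) * (1 + |μ2 - μ1| / (2 * b))) ∧
    (-2 * Real.log (∫ x : ℝ, Real.sqrt (laplaceDensity μ1 b x * laplaceDensity μ2 b x))
        = |μ2 - μ1| / b - 2 * Real.log (1 + |μ2 - μ1| / (2 * b))) := by
  refine ⟨integral_sqrt_laplaceDensity_mul_laplaceDensity μ1 μ2 hb, ?_⟩
  rw [integral_sqrt_laplaceDensity_mul_laplaceDensity μ1 μ2 hb,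
    Real.log_mul (Real.exp_pos _).ne' (by positivity), Real.log_exp]
  field_simp
  ring
end
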